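/- Let X be a separable real Hilbert space, f : X → ℝ convex, continuously differentiable, L-smooth with nonempty set of minimizers, and x⋆ its minimum-norm minimizer. Let C_α, C_λ > 0, p ∈ (0, 1], q ∈ [0, 1 − p], and assume: C_α < 2/L if q = 0; 2 C_λ C_α > 1 − q if q = 1 − p and q ≠ 0; and 2 C_λ C_α (1 − L C_α/2) > 1 if q = 0 and p = 1. Let (x_k) be generated by x_k = x_{k-1} − α_k(∇f(x_{k-1}) + λ_k x_{k-1}) with α_k = C_α k^{−q} and λ_k = C_λ k^{−p}. Then f(x_k) − f(x⋆) ∈ O(k^{−p}); moreover, if q ∈ [0, 1 − p), then ‖x_k − x_{λ_{k+1}}‖² ∈ O(k^{−1+q+p}) and lim_{k→∞} ‖x_k − x⋆‖ = 0. -/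

import Mathlib

open MeasureTheory Filter Asymptotics Real

section Tikhonov

variable {H : Type*} [NormedAddCommGroup H]

/-- The Tikhonov regularization `f + (l / 2) ‖·‖²`. -/
noncomputable def tikhonov (f : H → ℝ) (l : ℝ) (x : H) : ℝ := f x + l / 2 * ‖x‖ ^ 2

theorem norm_le_norm_of_isMinOn_tikhonov {f : H → ℝ} {l : ℝ} (hl : 0 < l) {m z : H}
    (hm : IsMinOn (tikhonov f l) Set.univ m) (hz : IsMinOn f Set.univ z) : ‖m‖ ≤ ‖z‖ := by
  have h1 : tikhonov f l m ≤ tikhonov f l z := hm (Set.mem_univ z)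
  have h2 : f z ≤ f m := hz (Set.mem_univ m)
  rw [tikhonov, tikhonov] at h1
  refine le_of_sq_le_sq ?_ (norm_nonneg z)
  have : l / 2 * ‖m‖ ^ 2 ≤ l / 2 * ‖z‖ ^ 2 := by linarith
  exact le_of_mul_le_mul_left this (by positivity)

end Tikhonov

section Gradient

variable {H : Type*} [NormedAddCommGroup H] [InnerProductSpace ℝ H] [CompleteSpace H]

theorem HasGradientAt.hasDerivAt_comp_lineMap {f : H → ℝ} {x y g : H} {t : ℝ}
    (hf : HasGradientAt f g (AffineMap.lineMap x y t)) :
    HasDerivAt (fun s : ℝ => f (AffineMap.lineMap x y s)) (inner ℝ g (y - x)) t := by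
  have h := hf.hasFDerivAt.comp_hasDerivAt t AffineMap.hasDerivAt_lineMap
  rw [InnerProductSpace.toDual_apply_apply] at h
  exact h

theorem ConvexOn.add_inner_gradient_le {f : H → ℝ} (hf : ConvexOn ℝ Set.univ f) {x g : H}
    (hg : HasGradientAt f g x) (y : H) : f x + inner ℝ g (y - x) ≤ f y := by
  have hd : HasDerivAt (fun s : ℝ => f (AffineMap.lineMap x y s)) (inner ℝ g (y - x)) 0 :=
    HasGradientAt.hasDerivAt_comp_lineMap (by simpa using hg)
  have hc : ConvexOn ℝ Set.univ (fun s : ℝ => f (AffineMap.lineMap x y s)) :=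
    hf.comp_affineMap (AffineMap.lineMap x y)
  have := hc.le_slope_of_hasDerivAt (Set.mem_univ 0) (Set.mem_univ 1) one_pos hd
  simp [slope_def_field] at this
  linarith

/-- The descent lemma for functions with Lipschitz gradient. -/
theorem le_add_inner_gradient_add_of_lipschitz {f : H → ℝ} {L : ℝ} (hL : 0 ≤ L)
    (hf : Differentiable ℝ f) (hLip : LipschitzWith L.toNNReal (gradient f)) (x y : H) :
    f y ≤ f x + inner ℝ (gradient f x) (y - x) + L / 2 * ‖y - x‖ ^ 2 := by
  have hd (t : ℝ) := HasGradientAt.hasDerivAt_comp_lineMap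
    (hf (AffineMap.lineMap x y t)).hasGradientAt
  have hB (t : ℝ) : HasDerivAt
      (fun s : ℝ => f x + s * inner ℝ (gradient f x) (y - x) + s ^ 2 * (L / 2 * ‖y - x‖ ^ 2))
      (inner ℝ (gradient f x) (y - x) + t * (L * ‖y - x‖ ^ 2)) t := by
    have := (((hasDerivAt_id t).mul_const (inner ℝ (gradient f x) (y - x))).const_add (f x)).add
      ((hasDerivAt_pow 2 t).mul_const (L / 2 * ‖y - x‖ ^ 2))
    exact this.congr_deriv (by simp; ring)
  have := image_le_of_deriv_right_le_deriv_boundary (a := 0) (b := 1)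
    (f := fun s : ℝ => f (AffineMap.lineMap x y s))
    (fun t _ => (hd t).continuousAt.continuousWithinAt) (fun t _ => (hd t).hasDerivWithinAt)
    (by simp) (fun t _ => (hB t).continuousAt.continuousWithinAt)
    (fun t _ => (hB t).hasDerivWithinAt) ?_ (Set.right_mem_Icc.2 zero_le_one)
  · simpa using this
  rintro t ⟨ht, -⟩
  have h1 : ‖gradient f (AffineMap.lineMap x y t) - gradient f x‖ ≤ L * (t * ‖y - x‖) := by
    have := hLip.dist_le_mul (AffineMap.lineMap x y t) x
    rwa [dist_lineMap_left, Real.coe_toNNReal _ hL, dist_eq_norm, Real.norm_of_nonneg ht,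
      dist_eq_norm'] at this
  have h2 := real_inner_le_norm (gradient f (AffineMap.lineMap x y t) - gradient f x) (y - x)
  rw [inner_sub_left] at h2
  have := mul_le_mul_of_nonneg_right h1 (norm_nonneg (y - x))
  nlinarith

theorem tikhonov_add_inner_add_le {f : H → ℝ} (hconv : ConvexOn ℝ Set.univ f)
    (hf : Differentiable ℝ f) (l : ℝ) (x y : H) :
    tikhonov f l x + inner ℝ (gradient f x + l • x) (y - x) + l / 2 * ‖y - x‖ ^ 2
      ≤ tikhonov f l y := by
  have h := hconv.add_inner_gradient_le (hf x).hasGradientAt y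
  have h1 : ‖y‖ ^ 2 = ‖x‖ ^ 2 + 2 * inner ℝ x (y - x) + ‖y - x‖ ^ 2 := by
    rw [← norm_add_sq_real, add_sub_cancel]
  rw [tikhonov, tikhonov, inner_add_left, real_inner_smul_left, h1]
  linarith

theorem gradient_add_smul_eq_zero_of_isMinOn_tikhonov {f : H → ℝ} (hf : Differentiable ℝ f)
    {l : ℝ} {m : H} (hm : IsMinOn (tikhonov f l) Set.univ m) : gradient f m + l • m = 0 := by
  have hd := (hf m).hasGradientAt.hasFDerivAt.add
    ((hasStrictFDerivAt_norm_sq m).hasFDerivAt.const_mul (l / 2))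
  have h0 := (hm.isLocalMin Filter.univ_mem).hasFDerivAt_eq_zero hd
  refine ext_inner_right ℝ fun v => ?_
  have := DFunLike.congr_fun h0 v
  simp at this
  rw [inner_add_left, real_inner_smul_left, inner_zero_left]
  simp only [gradient, InnerProductSpace.toDual_symm_apply]
  linarith

theorem tikhonov_quadratic_growth {f : H → ℝ} (hconv : ConvexOn ℝ Set.univ f)
    (hf : Differentiable ℝ f) {l : ℝ} {m : H} (hm : IsMinOn (tikhonov f l) Set.univ m) (y : H) :
    tikhonov f l m + l / 2 * ‖y - m‖ ^ 2 ≤ tikhonov f l y := by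
  simpa [gradient_add_smul_eq_zero_of_isMinOn_tikhonov hf hm] using
    tikhonov_add_inner_add_le hconv hf l m y

/-- The Polyak–Łojasiewicz inequality for the Tikhonov regularization of a convex function. -/
theorem tikhonov_polyak_lojasiewicz {f : H → ℝ} (hconv : ConvexOn ℝ Set.univ f)
    (hf : Differentiable ℝ f) {l : ℝ} (hl : 0 ≤ l) (x y : H) :
    2 * l * (tikhonov f l x - tikhonov f l y) ≤ ‖gradient f x + l • x‖ ^ 2 := by
  have h := tikhonov_add_inner_add_le hconv hf l x y
  have h1 := neg_le_of_abs_le (abs_real_inner_le_norm (gradient f x + l • x) (y - x))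
  have h2 : tikhonov f l x - tikhonov f l y ≤
      ‖gradient f x + l • x‖ * ‖y - x‖ - l / 2 * ‖y - x‖ ^ 2 := by linarith
  have := mul_le_mul_of_nonneg_left h2 hl
  nlinarith [sq_nonneg (‖gradient f x + l • x‖ - l * ‖y - x‖)]

theorem tikhonov_gradient_step_le {f : H → ℝ} {L : ℝ} (hL : 0 ≤ L) (hf : Differentiable ℝ f)
    (hLip : LipschitzWith L.toNNReal (gradient f)) (l a : ℝ) (x : H) :
    tikhonov f l (x - a • (gradient f x + l • x)) ≤
      tikhonov f l x - a * (1 - (L + l) * a / 2) * ‖gradient f x + l • x‖ ^ 2 := by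
  set v := gradient f x + l • x with hv
  have h := le_add_inner_gradient_add_of_lipschitz hL hf hLip x (x - a • v)
  have hd : x - a • v - x = -(a • v) := by abel
  have h1 : ‖x - a • v‖ ^ 2 = ‖x‖ ^ 2 - 2 * (a * inner ℝ x v) + a ^ 2 * ‖v‖ ^ 2 := by
    rw [norm_sub_sq_real, real_inner_smul_right, norm_smul, mul_pow, Real.norm_eq_abs, sq_abs]
  have h2 : inner ℝ (gradient f x) v + l * inner ℝ x v = ‖v‖ ^ 2 := by
    rw [← real_inner_smul_left, ← inner_add_left, ← hv, real_inner_self_eq_norm_sq]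
  rw [hd, inner_neg_right, real_inner_smul_right, norm_neg, norm_smul, mul_pow, Real.norm_eq_abs,
    sq_abs] at h
  rw [tikhonov, tikhonov, h1]
  linear_combination h - a * h2

theorem tikhonov_contraction {f : H → ℝ} {L : ℝ} (hL : 0 ≤ L) (hconv : ConvexOn ℝ Set.univ f)
    (hf : Differentiable ℝ f) (hLip : LipschitzWith L.toNNReal (gradient f)) {l a : ℝ}
    (hl : 0 ≤ l) (ha : 0 ≤ a) (hla : (L + l) * a / 2 ≤ 1) (x m : H) :
    tikhonov f l (x - a • (gradient f x + l • x)) - tikhonov f l m ≤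
      (1 - 2 * (l * a) * (1 - (L + l) * a / 2)) * (tikhonov f l x - tikhonov f l m) := by
  have h1 := tikhonov_gradient_step_le hL hf hLip l a x
  have h2 := mul_le_mul_of_nonneg_left (tikhonov_polyak_lojasiewicz hconv hf hl x m)
    (mul_nonneg ha (sub_nonneg.2 hla))
  linarith

theorem norm_sub_sq_le_of_isMinOn_tikhonov {f : H → ℝ} (hconv : ConvexOn ℝ Set.univ f)
    (hf : Differentiable ℝ f) {l l' : ℝ} (hl : 0 < l) (hll : l ≤ l') {m m' : H}
    (hm : IsMinOn (tikhonov f l) Set.univ m) (hm' : IsMinOn (tikhonov f l') Set.univ m') :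
    ‖m - m'‖ ^ 2 ≤ ‖m‖ ^ 2 - ‖m'‖ ^ 2 := by
  have h1 := tikhonov_quadratic_growth hconv hf hm m'
  have h2 := tikhonov_quadratic_growth hconv hf hm' m
  rw [norm_sub_rev] at h1
  simp only [tikhonov] at h1 h2
  have h3 : (l' + l) * ‖m - m'‖ ^ 2 ≤ (l' - l) * (‖m‖ ^ 2 - ‖m'‖ ^ 2) := by linarith
  rcases hll.eq_or_lt with rfl | hlt
  · have : ‖m - m'‖ ^ 2 ≤ 0 := by nlinarith [sq_nonneg ‖m - m'‖]
    have : m = m' := by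
      rw [← sub_eq_zero, ← norm_eq_zero]
      exact pow_eq_zero_iff two_ne_zero |>.1 (le_antisymm this (sq_nonneg _))
    simp [this]
  · refine le_of_mul_le_mul_left (a := l' - l) ?_ (sub_pos.2 hlt)
    nlinarith [sq_nonneg ‖m - m'‖]

/-- Tikhonov-regularized minimizers converge to the minimum-norm minimizer. -/
theorem tendsto_minimizer_tikhonov {f : H → ℝ} (hconv : ConvexOn ℝ Set.univ f)
    (hf : Differentiable ℝ f) {z : H} (hz : IsMinOn f Set.univ z)
    (hzmin : ∀ y, IsMinOn f Set.univ y → ‖z‖ ≤ ‖y‖) {l : ℕ → ℝ} (hl : ∀ n, 0 < l n)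
    (hanti : Antitone l) (hl0 : Tendsto l atTop (nhds 0)) {m : ℕ → H}
    (hm : ∀ n, IsMinOn (tikhonov f (l n)) Set.univ (m n)) : Tendsto m atTop (nhds z) := by
  have hdist {i j : ℕ} (hij : i ≤ j) : ‖m j - m i‖ ^ 2 ≤ ‖m j‖ ^ 2 - ‖m i‖ ^ 2 :=
    norm_sub_sq_le_of_isMinOn_tikhonov hconv hf (hl j) (hanti hij) (hm j) (hm i)
  have hmono : Monotone fun n => ‖m n‖ ^ 2 := fun i j hij => by
    have := hdist hij
    have := sq_nonneg ‖m j - m i‖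
    simp only
    linarith
  have hle (n : ℕ) : ‖m n‖ ≤ ‖z‖ := norm_le_norm_of_isMinOn_tikhonov (hl n) (hm n) hz
  have hbdd : BddAbove (Set.range fun n => ‖m n‖ ^ 2) := by
    refine ⟨‖z‖ ^ 2, ?_⟩
    rintro _ ⟨n, rfl⟩
    exact pow_le_pow_left₀ (norm_nonneg _) (hle n) 2
  have hcau : CauchySeq m := by
    rw [Metric.cauchySeq_iff']
    intro ε hε
    obtain ⟨N, hN⟩ := Metric.cauchySeq_iff'.1 (tendsto_atTop_ciSup hmono hbdd).cauchySeq (ε ^ 2)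
      (by positivity)
    refine ⟨N, fun n hn => ?_⟩
    rw [dist_eq_norm]
    refine lt_of_pow_lt_pow_left₀ 2 hε.le ?_
    calc ‖m n - m N‖ ^ 2 ≤ ‖m n‖ ^ 2 - ‖m N‖ ^ 2 := hdist hn
      _ ≤ dist (‖m n‖ ^ 2) (‖m N‖ ^ 2) := le_abs_self _
      _ < ε ^ 2 := hN n hn
  obtain ⟨y, hy⟩ := cauchySeq_tendsto_of_complete hcau
  have hfy : f y ≤ f z := by
    have h1 : Tendsto (fun n => f z + l n / 2 * ‖z‖ ^ 2) atTop (nhds (f z + 0 / 2 * ‖z‖ ^ 2)) :=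
      ((hl0.div_const 2).mul_const _).const_add _
    simp only [zero_div, zero_mul, add_zero] at h1
    refine le_of_tendsto_of_tendsto' ((hf.continuous.tendsto y).comp hy) h1 fun n => ?_
    have h2 : tikhonov f (l n) (m n) ≤ tikhonov f (l n) z := hm n (Set.mem_univ z)
    have h3 : 0 ≤ l n / 2 * ‖m n‖ ^ 2 := by have := hl n; positivity
    simp only [tikhonov] at h2
    simp only [Function.comp]
    linarith
  have hymin : IsMinOn f Set.univ y := fun w hw => hfy.trans (hz hw)
  have hyz : ‖z - y‖ ^ 2 ≤ ‖z‖ ^ 2 - ‖y‖ ^ 2 := by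
    refine le_of_tendsto_of_tendsto' ((hy.const_sub z).norm.pow 2) ((hy.norm.pow 2).const_sub _)
      fun n => ?_
    have h1 := tikhonov_quadratic_growth hconv hf (hm n) z
    have h2 : f z ≤ f (m n) := hz (Set.mem_univ _)
    simp only [tikhonov] at h1
    refine le_of_mul_le_mul_left (a := l n / 2) ?_ (half_pos (hl n))
    linarith
  have h0 : ‖z - y‖ ^ 2 ≤ 0 := by
    have := pow_le_pow_left₀ (norm_nonneg z) (hzmin y hymin) 2
    linarith
  have : z = y := by
    rw [← sub_eq_zero, ← norm_eq_zero]
    exact pow_eq_zero_iff two_ne_zero |>.1 (le_antisymm h0 (sq_nonneg _))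
  rwa [this]

end Gradient

section Rates

theorem natCast_succ_rpow_sub_le {p : ℝ} (hp : p ≤ 1) (n : ℕ) :
    ((n + 1 : ℕ) : ℝ) ^ (-p) - ((n + 2 : ℕ) : ℝ) ^ (-p) ≤ ((n + 1 : ℕ) : ℝ) ^ (-p - 1) := by
  have h1 : (0 : ℝ) < ((n + 1 : ℕ) : ℝ) := by positivity
  have h2 : (0 : ℝ) < ((n + 2 : ℕ) : ℝ) := by positivity
  have hle : ((n + 1 : ℕ) : ℝ) / ((n + 2 : ℕ) : ℝ) ≤ 1 := by
    rw [div_le_one h2]; push_cast; linarith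
  have h3 : ((n + 1 : ℕ) : ℝ) / ((n + 2 : ℕ) : ℝ)
      ≤ (((n + 1 : ℕ) : ℝ) / ((n + 2 : ℕ) : ℝ)) ^ p := by
    simpa using Real.rpow_le_rpow_of_exponent_ge (div_pos h1 h2) hle hp
  have h4 : ((n + 2 : ℕ) : ℝ) ^ (-p) =
      ((n + 1 : ℕ) : ℝ) ^ (-p) * (((n + 1 : ℕ) : ℝ) / ((n + 2 : ℕ) : ℝ)) ^ p := by
    rw [Real.div_rpow h1.le h2.le, Real.rpow_neg h1.le, Real.rpow_neg h2.le]
    have := Real.rpow_pos_of_pos h1 p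
    field_simp
  have h5 : 1 - ((n + 1 : ℕ) : ℝ) / ((n + 2 : ℕ) : ℝ) ≤ 1 / ((n + 1 : ℕ) : ℝ) := by
    rw [one_sub_div h2.ne', div_le_div_iff₀ h2 h1]; push_cast; linarith
  have h6 := Real.rpow_pos_of_pos h1 (-p)
  rw [h4, Real.rpow_sub_one h1.ne', div_eq_mul_one_div (((n + 1 : ℕ) : ℝ) ^ (-p))]
  nlinarith

/-- Chung's lemma: a nonnegative sequence contracting at rate `1 - D n ^ (-r)` up to an error
`c n ^ (-r - s)` is eventually bounded by a multiple of `n ^ (-s)`. -/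
theorem eventually_le_mul_rpow_of_contraction {E : ℕ → ℝ} {D c r s : ℝ} (hc : 0 ≤ c)
    (hD : 0 < D) (hr : 0 < r) (hr1 : r ≤ 1) (hs : 0 < s) (hs1 : s ≤ 1) (hDs : r = 1 → s < D)
    (hE : ∀ᶠ n : ℕ in atTop, E (n + 1) ≤
      (1 - D * ((n + 1 : ℕ) : ℝ) ^ (-r)) * E n + c * ((n + 1 : ℕ) : ℝ) ^ (-r - s)) :
    ∃ M, 0 ≤ M ∧ ∀ᶠ n : ℕ in atTop, E n ≤ M * (n : ℝ) ^ (-s) := by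
  have hcast : Tendsto (fun n : ℕ => ((n + 1 : ℕ) : ℝ)) atTop atTop :=
    tendsto_natCast_atTop_atTop.comp (tendsto_add_atTop_nat 1)
  obtain ⟨η, hη, hηs⟩ : ∃ η, 0 < η ∧ ∀ᶠ n : ℕ in atTop,
      s / (n : ℝ) ≤ (D - η) * ((n + 1 : ℕ) : ℝ) ^ (-r) := by
    have key (η t : ℝ) (ht : Tendsto (fun n : ℕ => s * (((n + 1 : ℕ) : ℝ) ^ (r - 1) *
        (((n + 1 : ℕ) : ℝ) / n))) atTop (nhds t)) (htη : t < D - η) : ∀ᶠ n : ℕ in atTop,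
      s / (n : ℝ) ≤ (D - η) * ((n + 1 : ℕ) : ℝ) ^ (-r) := by
      filter_upwards [ht.eventually_lt_const htη, eventually_gt_atTop 0] with n hn hn0
      have h1 : (0 : ℝ) < ((n + 1 : ℕ) : ℝ) := by positivity
      have h0 : (0 : ℝ) < n := by exact_mod_cast hn0
      have hpos := Real.rpow_pos_of_pos h1 r
      have : s / (n : ℝ) = s * (((n + 1 : ℕ) : ℝ) ^ (r - 1) * (((n + 1 : ℕ) : ℝ) / n)) *
          ((n + 1 : ℕ) : ℝ) ^ (-r) := by
        rw [Real.rpow_sub_one h1.ne', Real.rpow_neg h1.le]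
        field_simp
      rw [this]
      gcongr
    have hquot : Tendsto (fun n : ℕ => ((n + 1 : ℕ) : ℝ) / n) atTop (nhds 1) := by
      have h := (tendsto_one_div_atTop_nhds_zero_nat (𝕜 := ℝ)).const_add 1
      rw [add_zero] at h
      refine h.congr' ?_
      filter_upwards [eventually_gt_atTop 0] with n hn
      have : (n : ℝ) ≠ 0 := by exact_mod_cast hn.ne'
      push_cast
      field_simp
    rcases hr1.eq_or_lt with rfl | hlt
    · have := hDs rfl
      refine ⟨(D - s) / 2, by linarith, key _ s ?_ (by linarith)⟩
      simpa using hquot.const_mul s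
    · refine ⟨D / 2, by linarith, key _ 0 ?_ (by linarith)⟩
      have h := (tendsto_rpow_neg_atTop (sub_pos.2 hlt)).comp hcast
      simp only [neg_sub] at h
      simpa using (h.mul hquot).const_mul s
  have hsmall : ∀ᶠ n : ℕ in atTop, D * ((n + 1 : ℕ) : ℝ) ^ (-r) ≤ 1 := by
    have h := ((tendsto_rpow_neg_atTop hr).comp hcast).const_mul D
    rw [mul_zero] at h
    exact h.eventually_le_const one_pos
  obtain ⟨N, hN⟩ := eventually_atTop.1
    (((hE.and hηs).and hsmall).and (eventually_gt_atTop 0))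
  have hN0 : (0 : ℝ) < N := by exact_mod_cast (hN N le_rfl).2
  refine ⟨max (c / η) (E N * (N : ℝ) ^ s), le_max_of_le_left (by positivity), ?_⟩
  set M := max (c / η) (E N * (N : ℝ) ^ s) with hM
  have hcM : c ≤ M * η := by
    rw [← div_le_iff₀ hη]; exact le_max_left _ _
  have hM0 : 0 ≤ M := le_max_of_le_left (by positivity)
  refine eventually_atTop.2 ⟨N, fun n hn => ?_⟩
  induction n, hn using Nat.le_induction with
  | base =>
    rw [Real.rpow_neg hN0.le, ← div_eq_mul_inv, le_div_iff₀ (Real.rpow_pos_of_pos hN0 s)]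
    exact le_max_right _ _
  | succ n hn ih =>
    obtain ⟨⟨⟨h1, h2⟩, h3⟩, h4⟩ := hN n hn
    have hn0 : (0 : ℝ) < n := by exact_mod_cast h4
    have hk : (0 : ℝ) < ((n + 1 : ℕ) : ℝ) := by positivity
    set k : ℝ := ((n + 1 : ℕ) : ℝ) with hkdef
    have hpow : (n : ℝ) ^ (-s) ≤ k ^ (-s) * (1 + s / n) := by
      have hb := rpow_one_add_le_one_add_mul_self (s := 1 / (n : ℝ))
        (by have : 0 ≤ 1 / (n : ℝ) := by positivity
            linarith) hs.le hs1
      have he : (1 + 1 / (n : ℝ)) = k / n := by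
        rw [hkdef]; push_cast; field_simp
      rw [he, Real.div_rpow hk.le hn0.le, mul_one_div] at hb
      have hks := Real.rpow_pos_of_pos hk s
      have hns := Real.rpow_pos_of_pos hn0 s
      calc (n : ℝ) ^ (-s) = k ^ (-s) * (k ^ s / (n : ℝ) ^ s) := by
            rw [Real.rpow_neg hk.le, Real.rpow_neg hn0.le]; field_simp
        _ ≤ _ := by gcongr
    have hkr := Real.rpow_pos_of_pos hk (-r)
    have hks := Real.rpow_pos_of_pos hk (-s)
    have hsplit : k ^ (-r - s) = k ^ (-r) * k ^ (-s) := by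
      rw [← Real.rpow_add hk, sub_eq_add_neg]
    have hfac : (1 - D * k ^ (-r)) * (1 + s / n) ≤ 1 - η * k ^ (-r) := by
      have : 0 ≤ D * k ^ (-r) * (s / n) := by positivity
      linarith
    calc E (n + 1) ≤ (1 - D * k ^ (-r)) * E n + c * k ^ (-r - s) := h1
      _ ≤ (1 - D * k ^ (-r)) * (M * (k ^ (-s) * (1 + s / n)))
          + M * η * (k ^ (-r) * k ^ (-s)) := by
        rw [hsplit]
        have : 0 ≤ 1 - D * k ^ (-r) := by linarith
        gcongr
        exact ih.trans (by gcongr)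
      _ = M * k ^ (-s) * ((1 - D * k ^ (-r)) * (1 + s / n) + η * k ^ (-r)) := by ring
      _ ≤ M * k ^ (-s) * 1 := by
        gcongr
        linarith
      _ = M * k ^ (-s) := mul_one _

end Rates



theorem regGD_gap_and_convergence
    {H : Type*} [NormedAddCommGroup H] [InnerProductSpace ℝ H] [CompleteSpace H]
    [TopologicalSpace.SeparableSpace H]
    (f : H → ℝ) (L : ℝ) (hL : 0 < L)
    (hconv : ConvexOn ℝ Set.univ f)
    (hC1 : ContDiff ℝ 1 f)
    (hLip : LipschitzWith L.toNNReal (gradient f))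
    (xstar : H) (hxmin : IsMinOn f Set.univ xstar)
    (hminnorm : ∀ y : H, IsMinOn f Set.univ y → ‖xstar‖ ≤ ‖y‖)
    (xlam : ℝ → H)
    (hxlam : ∀ l : ℝ, 0 < l → IsMinOn (fun x => f x + l / 2 * ‖x‖ ^ 2) Set.univ (xlam l))
    (Cα Clam p q : ℝ) (hCα : 0 < Cα) (hClam : 0 < Clam)
    (hp : 0 < p ∧ p ≤ 1) (hq : 0 ≤ q ∧ q ≤ 1 - p)
    (hcond1 : q = 0 → Cα < 2 / L)
    (hcond2 : q = 1 - p ∧ q ≠ 0 → 2 * Clam * Cα > 1 - q)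
    (hcond3 : q = 0 ∧ p = 1 → 2 * Clam * Cα * (1 - L * Cα / 2) > 1)
    (α lam : ℕ → ℝ)
    (hαdef : ∀ k : ℕ, α k = Cα * (k : ℝ) ^ (-q))
    (hlamdef : ∀ k : ℕ, lam k = Clam * (k : ℝ) ^ (-p))
    (x : ℕ → H)
    (hrec : ∀ k : ℕ, x (k + 1) = x k - α (k + 1) • (gradient f (x k) + lam (k + 1) • x k))
    :
    ((fun k : ℕ => f (x k) - f xstar) =O[atTop] fun k : ℕ => (k : ℝ) ^ (-p)) ∧
    (q < 1 - p →
      ((fun k : ℕ => ‖x k - xlam (lam (k + 1))‖ ^ 2) =O[atTop]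
        fun k : ℕ => (k : ℝ) ^ (q + p - 1)) ∧
      Tendsto (fun k : ℕ => ‖x k - xstar‖) atTop (nhds 0)) := by
  have hf : Differentiable ℝ f := hC1.differentiable one_ne_zero
  obtain ⟨hp0, hp1⟩ := hp
  obtain ⟨hq0, hqp⟩ := hq
  have hcast : Tendsto (fun n : ℕ => ((n + 1 : ℕ) : ℝ)) atTop atTop :=
    tendsto_natCast_atTop_atTop.comp (tendsto_add_atTop_nat 1)
  have hlam_pos (n : ℕ) : 0 < lam (n + 1) := by rw [hlamdef]; positivity
  have hlam_anti : Antitone fun n => lam (n + 1) := fun i j hij => by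
    simp only [hlamdef]
    gcongr 1
    exact Real.rpow_le_rpow_of_nonpos (by positivity) (by gcongr) (by linarith)
  have hlam_zero : Tendsto (fun n => lam (n + 1)) atTop (nhds 0) := by
    simp only [hlamdef]
    simpa using ((tendsto_rpow_neg_atTop hp0).comp hcast).const_mul Clam
  have hm (n : ℕ) : IsMinOn (tikhonov f (lam (n + 1))) Set.univ (xlam (lam (n + 1))) :=
    hxlam _ (hlam_pos n)
  have hα_nonneg (n : ℕ) : 0 ≤ α n := by rw [hαdef]; positivity
  obtain ⟨ρ, hρ, hρ1, hρT⟩ : ∃ ρ, Tendsto (fun n => (L + lam (n + 1)) * α (n + 1) / 2) atTop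
      (nhds ρ) ∧ ρ < 1 ∧ (p + q = 1 → 1 - q < 2 * (Clam * Cα) * (1 - ρ)) := by
    have hsum := hlam_zero.const_add L
    rw [add_zero] at hsum
    rcases hq0.eq_or_lt with rfl | hqpos
    · refine ⟨L * Cα / 2, ?_, ?_, fun h => ?_⟩
      · simp only [hαdef, neg_zero, Real.rpow_zero, mul_one]
        exact (hsum.mul_const Cα).div_const 2
      · have := hcond1 rfl
        rw [lt_div_iff₀ hL] at this
        linarith
      · have := hcond3 ⟨rfl, by linarith⟩
        linarith
    · refine ⟨0, ?_, one_pos, fun h => ?_⟩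
      · simp only [hαdef]
        have := ((tendsto_rpow_neg_atTop hqpos).comp hcast).const_mul Cα
        simpa using (hsum.mul this).div_const 2
      · have := hcond2 ⟨by linarith, hqpos.ne'⟩
        linarith
  have hT : 0 < 2 * (Clam * Cα) * (1 - ρ) := mul_pos (by positivity) (sub_pos.2 hρ1)
  obtain ⟨D, hD, hDT, hDq⟩ : ∃ D, 0 < D ∧ D < 2 * (Clam * Cα) * (1 - ρ) ∧
      (p + q = 1 → 1 - q < D) := by
    by_cases h : p + q = 1
    · obtain ⟨D, h1, h2⟩ := exists_between (hρT h)
      exact ⟨D, by linarith, h2, fun _ => h1⟩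
    · obtain ⟨D, h1, h2⟩ := exists_between hT
      exact ⟨D, h1, h2, fun h' => absurd h' h⟩
  set E : ℕ → ℝ := fun n => tikhonov f (lam (n + 1)) (x n) -
    tikhonov f (lam (n + 1)) (xlam (lam (n + 1))) with hEdef
  have hE_nonneg (n : ℕ) : 0 ≤ E n := sub_nonneg.2 (hm n (Set.mem_univ _))
  have hstep : ∀ᶠ n : ℕ in atTop, E (n + 1) ≤ (1 - D * ((n + 1 : ℕ) : ℝ) ^ (-(p + q))) * E n +
      Clam / 2 * ‖xstar‖ ^ 2 * ((n + 1 : ℕ) : ℝ) ^ (-(p + q) - (1 - q)) := by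
    filter_upwards [hρ.eventually_le_const hρ1,
      ((hρ.const_sub 1).const_mul (2 * (Clam * Cα))).eventually_const_le hDT] with n h1 h2
    have hk : (0 : ℝ) < ((n + 1 : ℕ) : ℝ) := by positivity
    have hcontr := tikhonov_contraction hL.le hconv hf hLip (hlam_pos n).le (hα_nonneg (n + 1)) h1
      (x n) (xlam (lam (n + 1)))
    rw [← hrec n] at hcontr
    have hprod : lam (n + 1) * α (n + 1) = Clam * Cα * ((n + 1 : ℕ) : ℝ) ^ (-(p + q)) := by
      rw [hlamdef, hαdef, neg_add, Real.rpow_add hk]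
      ring
    have hfac : D * ((n + 1 : ℕ) : ℝ) ^ (-(p + q)) ≤
        2 * (lam (n + 1) * α (n + 1)) * (1 - (L + lam (n + 1)) * α (n + 1) / 2) := by
      rw [hprod]
      have := mul_le_mul_of_nonneg_right h2 (Real.rpow_nonneg hk.le (-(p + q)))
      linarith
    have hdecr : lam (n + 2) ≤ lam (n + 1) := hlam_anti n.le_succ
    have hnorm : ‖xlam (lam (n + 2))‖ ^ 2 ≤ ‖xstar‖ ^ 2 := pow_le_pow_left₀ (norm_nonneg _)
      (norm_le_norm_of_isMinOn_tikhonov (hlam_pos (n + 1)) (hm (n + 1)) hxmin) 2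
    have hnoise : lam (n + 1) - lam (n + 2) ≤
        Clam * ((n + 1 : ℕ) : ℝ) ^ (-(p + q) - (1 - q)) := by
      rw [hlamdef, hlamdef, ← mul_sub, show -(p + q) - (1 - q) = -p - 1 by ring]
      exact mul_le_mul_of_nonneg_left (natCast_succ_rpow_sub_le hp1 n) hClam.le
    have hmin : tikhonov f (lam (n + 1)) (xlam (lam (n + 1))) ≤
        tikhonov f (lam (n + 1)) (xlam (lam (n + 2))) := hm n (Set.mem_univ _)
    have hshift (y : H) : tikhonov f (lam (n + 2)) y =
        tikhonov f (lam (n + 1)) y - (lam (n + 1) - lam (n + 2)) / 2 * ‖y‖ ^ 2 := by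
      simp only [tikhonov]
      ring
    have hx_nonneg : 0 ≤ (lam (n + 1) - lam (n + 2)) / 2 * ‖x (n + 1)‖ ^ 2 :=
      mul_nonneg (by linarith) (sq_nonneg _)
    have hprodnoise : (lam (n + 1) - lam (n + 2)) / 2 * ‖xlam (lam (n + 2))‖ ^ 2 ≤
        Clam / 2 * ‖xstar‖ ^ 2 * ((n + 1 : ℕ) : ℝ) ^ (-(p + q) - (1 - q)) := by
      calc _ ≤ Clam * ((n + 1 : ℕ) : ℝ) ^ (-(p + q) - (1 - q)) / 2 * ‖xstar‖ ^ 2 := by gcongr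
        _ = _ := by ring
    have hEn := mul_le_mul_of_nonneg_right hfac (hE_nonneg n)
    have hEsucc : E (n + 1) = tikhonov f (lam (n + 2)) (x (n + 1)) -
        tikhonov f (lam (n + 2)) (xlam (lam (n + 2))) := rfl
    have hcontr' : tikhonov f (lam (n + 1)) (x (n + 1)) -
        tikhonov f (lam (n + 1)) (xlam (lam (n + 1))) ≤
        (1 - 2 * (lam (n + 1) * α (n + 1)) * (1 - (L + lam (n + 1)) * α (n + 1) / 2)) * E n :=
      hcontr
    rw [hEsucc, hshift, hshift]
    linarith
  obtain ⟨M, hM0, hM⟩ := eventually_le_mul_rpow_of_contraction (by positivity) hD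
    (by linarith) (by linarith) (by linarith) (by linarith) hDq hstep
  refine ⟨?_, fun hlt => ?_⟩
  · refine IsBigO.of_bound (M + Clam / 2 * ‖xstar‖ ^ 2) ?_
    filter_upwards [hM, eventually_ge_atTop 1] with n hn hn1
    have hn1' : (1 : ℝ) ≤ n := by exact_mod_cast hn1
    have h0 : 0 ≤ f (x n) - f xstar := sub_nonneg.2 (hxmin (Set.mem_univ _))
    have h1 : tikhonov f (lam (n + 1)) (xlam (lam (n + 1))) ≤ tikhonov f (lam (n + 1)) xstar :=
      hm n (Set.mem_univ _)
    have h2 : f (x n) - f xstar ≤ E n + lam (n + 1) / 2 * ‖xstar‖ ^ 2 := by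
      have : 0 ≤ lam (n + 1) / 2 * ‖x n‖ ^ 2 := by have := hlam_pos n; positivity
      simp only [hEdef]
      simp only [tikhonov] at h1 ⊢
      linarith
    have h3 : (n : ℝ) ^ (-(1 - q)) ≤ (n : ℝ) ^ (-p) :=
      Real.rpow_le_rpow_of_exponent_le hn1' (by linarith)
    have h4 : lam (n + 1) ≤ Clam * (n : ℝ) ^ (-p) := by
      rw [hlamdef]
      gcongr 1
      exact Real.rpow_le_rpow_of_nonpos (by linarith) (by push_cast; linarith) (by linarith)
    rw [Real.norm_of_nonneg h0, Real.norm_of_nonneg (by positivity)]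
    calc f (x n) - f xstar ≤ M * (n : ℝ) ^ (-(1 - q)) + lam (n + 1) / 2 * ‖xstar‖ ^ 2 := by
          linarith
      _ ≤ M * (n : ℝ) ^ (-p) + Clam * (n : ℝ) ^ (-p) / 2 * ‖xstar‖ ^ 2 := by gcongr
      _ = _ := by ring
  have hO : (fun k : ℕ => ‖x k - xlam (lam (k + 1))‖ ^ 2) =O[atTop]
      fun k : ℕ => (k : ℝ) ^ (q + p - 1) := by
    refine IsBigO.of_bound (2 / Clam * 2 ^ p * M) ?_
    filter_upwards [hM, eventually_ge_atTop 1] with n hn hn1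
    have hn1' : (1 : ℝ) ≤ n := by exact_mod_cast hn1
    have hn0 : (0 : ℝ) < n := by linarith
    have hk : (0 : ℝ) < ((n + 1 : ℕ) : ℝ) := by positivity
    have h1 : lam (n + 1) / 2 * ‖x n - xlam (lam (n + 1))‖ ^ 2 ≤ E n :=
      le_sub_iff_add_le'.2 (tikhonov_quadratic_growth hconv hf (hm n) (x n))
    have h2 : ((n + 1 : ℕ) : ℝ) ^ p ≤ 2 ^ p * (n : ℝ) ^ p := by
      rw [← Real.mul_rpow zero_le_two hn0.le]
      exact Real.rpow_le_rpow hk.le (by push_cast; linarith) hp0.le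
    rw [Real.norm_of_nonneg (by positivity), Real.norm_of_nonneg (by positivity)]
    calc ‖x n - xlam (lam (n + 1))‖ ^ 2
        = 2 / Clam * ((n + 1 : ℕ) : ℝ) ^ p *
          (lam (n + 1) / 2 * ‖x n - xlam (lam (n + 1))‖ ^ 2) := by
          generalize ‖x n - xlam (lam (n + 1))‖ ^ 2 = t
          rw [hlamdef, Real.rpow_neg hk.le]
          have := Real.rpow_pos_of_pos hk p
          field_simp
      _ ≤ 2 / Clam * (2 ^ p * (n : ℝ) ^ p) * (M * (n : ℝ) ^ (-(1 - q))) := by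
          have hpos : 0 ≤ lam (n + 1) / 2 * ‖x n - xlam (lam (n + 1))‖ ^ 2 := by
            have := hlam_pos n
            positivity
          have := h1.trans hn
          gcongr
      _ = 2 / Clam * 2 ^ p * M * ((n : ℝ) ^ p * (n : ℝ) ^ (-(1 - q))) := by ring
      _ = _ := by
          rw [← Real.rpow_add hn0]
          ring_nf
  refine ⟨hO, ?_⟩
  have hneg : Tendsto (fun k : ℕ => (k : ℝ) ^ (q + p - 1)) atTop (nhds 0) := by
    have := (tendsto_rpow_neg_atTop (y := 1 - (q + p)) (by linarith)).comp
      tendsto_natCast_atTop_atTop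
    simpa only [neg_sub, Function.comp_def] using this
  have hgap : Tendsto (fun k => ‖x k - xlam (lam (k + 1))‖) atTop (nhds 0) := by
    have := (hO.trans_tendsto hneg).sqrt
    simpa using this
  have hconvm := tendsto_iff_norm_sub_tendsto_zero.1
    (tendsto_minimizer_tikhonov hconv hf hxmin hminnorm hlam_pos hlam_anti hlam_zero hm)
  refine squeeze_zero (fun _ => norm_nonneg _) (fun k => norm_sub_le_norm_sub_add_norm_sub _ _ _)
    (by simpa using hgap.add hconvm)
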